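/- There exist δ₀ > 0, a neighborhood of M^δ on which both nearest-point projections p and p_δ are defined, and a constant C > 0 such that for all 0 < δ ≤ δ₀ and every Y in this neighborhood, |p̃_δ(Y) − p_δ(Y)| ≤ C δ · dist(Y, M^δ), where p̃_δ(Y) is the phase φ ∈ ℝ/L_δℝ satisfying q_δ(φ) = q̃_δ(p(Y)). -/

import Mathlib

noncomputable section

open MeasureTheory Set Filter RealInnerProductSpace

/-- The Hessian of `V` at `X`, as a continuous linear map. -/
def hessLM {n : ℕ} (V : EuclideanSpace ℝ (Fin n) → ℝ) (X : EuclideanSpace ℝ (Fin n)) :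
    EuclideanSpace ℝ (Fin n) →L[ℝ] EuclideanSpace ℝ (Fin n) :=
  fderiv ℝ (gradient V) X

/-- The perturbed invariant curve `M^δ = {q θ + φ_δ θ}`. -/
def Mset {n : ℕ} (q : ℝ → EuclideanSpace ℝ (Fin n)) (Φ : ℝ → ℝ → EuclideanSpace ℝ (Fin n))
    (δ : ℝ) : Set (EuclideanSpace ℝ (Fin n)) :=
  Set.range fun θ => q θ + Φ δ θ

/-- Invariance of a set under the flow `dX = (-∇V[X] + δ G[X]) dt`. -/
def flowInvariant {n : ℕ} (V : EuclideanSpace ℝ (Fin n) → ℝ)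
    (G : EuclideanSpace ℝ (Fin n) → EuclideanSpace ℝ (Fin n)) (δ : ℝ)
    (S : Set (EuclideanSpace ℝ (Fin n))) : Prop :=
  ∀ Y : ℝ → EuclideanSpace ℝ (Fin n),
    (∀ t, HasDerivAt Y (-(gradient V (Y t)) + δ • G (Y t)) t) → Y 0 ∈ S → ∀ t, Y t ∈ S

/-- Costs of finite-time absolutely continuous paths from `P₁` to `P₂` for the
rate function `I_{δ,T}`. -/
def rateSet {n : ℕ} (V : EuclideanSpace ℝ (Fin n) → ℝ)
    (G : EuclideanSpace ℝ (Fin n) → EuclideanSpace ℝ (Fin n)) (δ : ℝ)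
    (P₁ P₂ : EuclideanSpace ℝ (Fin n)) : Set ℝ :=
  {c | ∃ T : ℝ, T < 0 ∧ ∃ Y g : ℝ → EuclideanSpace ℝ (Fin n),
      IntervalIntegrable g volume T 0 ∧
      (∀ t ∈ Icc T (0:ℝ), Y t = Y T + ∫ s in T..t, g s) ∧
      Y T = P₁ ∧ Y 0 = P₂ ∧
      c = (1/2) * ∫ t in T..(0:ℝ), ‖g t + gradient V (Y t) - δ • G (Y t)‖^2}

/-- The quasipotential `W_δ(P₁, P₂)`. -/
def quasipotential {n : ℕ} (V : EuclideanSpace ℝ (Fin n) → ℝ)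
    (G : EuclideanSpace ℝ (Fin n) → EuclideanSpace ℝ (Fin n)) (δ : ℝ)
    (P₁ P₂ : EuclideanSpace ℝ (Fin n)) : ℝ :=
  sInf (rateSet V G δ P₁ P₂)

/-- Costs of absolutely continuous paths on `ℝ/L_δℝ` (written through `L_δ`-periodic lifts)
from `φ₁` to `φ₂` for the reduced rate function. -/
def redRateSet (bδ : ℝ → ℝ) (Lδ φ₁ φ₂ : ℝ) : Set ℝ :=
  {c | ∃ T : ℝ, T < 0 ∧ ∃ f g : ℝ → ℝ,
      IntervalIntegrable g volume T 0 ∧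
      (∀ t ∈ Icc T (0:ℝ), f t = f T + ∫ s in T..t, g s) ∧
      (∃ k : ℤ, f T = φ₁ + k * Lδ) ∧ (∃ k : ℤ, f 0 = φ₂ + k * Lδ) ∧
      c = (1/2) * ∫ t in T..(0:ℝ), |g t - bδ (f t)|^2}

/-- The reduced quasipotential `W^red_δ(φ₁, φ₂)`. -/
def redQuasipotential (bδ : ℝ → ℝ) (Lδ φ₁ φ₂ : ℝ) : ℝ :=
  sInf (redRateSet bδ Lδ φ₁ φ₂)

/-- The reduced drift `b_δ(φ) = ⟨-∇V[q_δ(φ)] + δ G[q_δ(φ)], q_δ'(φ)⟩`. -/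
def reducedDrift {n : ℕ} (V : EuclideanSpace ℝ (Fin n) → ℝ)
    (G : EuclideanSpace ℝ (Fin n) → EuclideanSpace ℝ (Fin n))
    (Qd : ℝ → EuclideanSpace ℝ (Fin n)) (δ φ : ℝ) : ℝ :=
  ⟪-(gradient V (Qd φ)) + δ • G (Qd φ), deriv Qd φ⟫

/-- The tube `U^δ` around `M^δ`. -/
def tubeU {n : ℕ} (q : ℝ → EuclideanSpace ℝ (Fin n)) (Φ : ℝ → ℝ → EuclideanSpace ℝ (Fin n))
    (Pd : ℝ → EuclideanSpace ℝ (Fin n) → ℝ) (phiA : ℝ → ℝ) (C₀ Δ₁ Δ₂ δ : ℝ) :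
    Set (EuclideanSpace ℝ (Fin n)) :=
  {Z | Metric.infDist Z (Mset q Φ δ) ≤ C₀ * Real.sqrt δ ∧
       Pd δ Z ∈ Icc (phiA δ - Δ₁) (phiA δ + Δ₂)}

/-- Costs of infinite-time paths from `A` (at `-∞`) to `B` (at time `0`). -/
def infRateSet {n : ℕ} (V : EuclideanSpace ℝ (Fin n) → ℝ)
    (G : EuclideanSpace ℝ (Fin n) → EuclideanSpace ℝ (Fin n)) (δ : ℝ)
    (A B : EuclideanSpace ℝ (Fin n)) : Set ℝ :=
  {c | ∃ Y g : ℝ → EuclideanSpace ℝ (Fin n),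
      ContinuousOn Y (Iic 0) ∧ Tendsto Y atBot (nhds A) ∧ Y 0 = B ∧
      (∀ T < (0:ℝ), IntervalIntegrable g volume T 0) ∧
      (∀ t ≤ (0:ℝ), Y 0 = Y t + ∫ s in t..(0:ℝ), g s) ∧
      c = (1/2) * ∫ t in Iic (0:ℝ), ‖g t + gradient V (Y t) - δ • G (Y t)‖^2}

/-- `Y` is an optimal path from `A` (at `-∞`) to `B` (at time `0`): it is continuous,
absolutely continuous with derivative `g`, and its infinite-time cost realizes the
quasipotential `W_δ(A, B)`. -/
def IsOptimalPath {n : ℕ} (V : EuclideanSpace ℝ (Fin n) → ℝ)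
    (G : EuclideanSpace ℝ (Fin n) → EuclideanSpace ℝ (Fin n)) (δ : ℝ)
    (A B : EuclideanSpace ℝ (Fin n)) (Y : ℝ → EuclideanSpace ℝ (Fin n)) : Prop :=
  ContinuousOn Y (Iic 0) ∧ Tendsto Y atBot (nhds A) ∧ Y 0 = B ∧
  ∃ g : ℝ → EuclideanSpace ℝ (Fin n),
    (∀ T < (0:ℝ), IntervalIntegrable g volume T 0) ∧
    (∀ t ≤ (0:ℝ), Y 0 = Y t + ∫ s in t..(0:ℝ), g s) ∧
    (1/2) * (∫ t in Iic (0:ℝ), ‖g t + gradient V (Y t) - δ • G (Y t)‖^2) =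
      quasipotential V G δ A B

section CurveLemmas

variable {E : Type*} [NormedAddCommGroup E]

lemma exists_int_abs_add_sub_lt_of_periodic {q : ℝ → E} {L : ℝ} (hL : 0 < L)
    (hq : Continuous q) (hper : Function.Periodic q L)
    (hinj : ∀ θ₁ θ₂ : ℝ, q θ₁ = q θ₂ → ∃ k : ℤ, θ₂ - θ₁ = k * L) {η : ℝ} (hη : 0 < η) :
    ∃ ρ > (0 : ℝ), ∀ θ σ : ℝ, ‖q θ - q σ‖ < ρ → ∃ k : ℤ, |θ + k * L - σ| < η := by
  let S : Set (ℝ × ℝ) := (Icc 0 L ×ˢ Icc 0 L) ∩ ⋂ k : ℤ, {x | η ≤ |x.1 + k * L - x.2|}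
  have hS : IsCompact S := by
    refine (isCompact_Icc.prod isCompact_Icc).inter_right (isClosed_iInter fun k => ?_)
    exact isClosed_le (by fun_prop) (by fun_prop)
  obtain ⟨ρ, hρ, hmin⟩ : ∃ ρ > (0 : ℝ), ∀ x ∈ S, ρ ≤ ‖q x.1 - q x.2‖ := by
    rcases S.eq_empty_or_nonempty with hne | hne
    · exact ⟨1, one_pos, by simp [hne]⟩
    · obtain ⟨x, hx, hxmin⟩ := hS.exists_isMinOn hne
        (f := fun x : ℝ × ℝ => ‖q x.1 - q x.2‖) (by fun_prop)
      refine ⟨_, norm_pos_iff.2 fun h => ?_, fun y hy => hxmin hy⟩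
      obtain ⟨k, hk⟩ := hinj _ _ (sub_eq_zero.1 h)
      have := mem_iInter.1 hx.2 k
      simp only [mem_ofPred_eq, ← hk] at this
      norm_num at this
      linarith
  refine ⟨ρ, hρ, fun θ σ h => ?_⟩
  have shift : ∀ x : ℝ, ∃ m : ℤ, x + m * L ∈ Icc 0 L ∧ q (x + m * L) = q x := fun x => by
    refine ⟨-⌊x / L⌋, ⟨?_, ?_⟩, ?_⟩
    · have := mul_le_mul_of_nonneg_right (Int.floor_le (x / L)) hL.le
      rw [div_mul_cancel₀ _ hL.ne'] at this
      push_cast; linarith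
    · have := mul_le_mul_of_nonneg_right (Int.lt_floor_add_one (x / L)).le hL.le
      rw [div_mul_cancel₀ _ hL.ne'] at this
      push_cast; linarith
    · exact hper.int_mul _ x
  obtain ⟨m, hm, hqm⟩ := shift θ
  obtain ⟨l, hl, hql⟩ := shift σ
  by_contra! hcon
  refine absurd (hmin (θ + m * L, σ + l * L) ⟨⟨hm, hl⟩, mem_iInter.2 fun k => ?_⟩) ?_
  · have := hcon (m + k - l)
    push_cast at this
    exact this.trans_eq (congrArg abs (by ring))
  · simpa [hqm, hql] using h

lemma deriv_periodic_of_periodic [NormedSpace ℝ E] {f : ℝ → E} {L : ℝ}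
    (h : Function.Periodic f L) : Function.Periodic (deriv f) L := fun x => by
  rw [← deriv_comp_add_const f L x]
  congr 1
  exact funext h

lemma exists_norm_deriv_sub_le_of_periodic [NormedSpace ℝ E] {q : ℝ → E} {L : ℝ} (hL : 0 < L)
    (hq : ContDiff ℝ 2 q) (hper : Function.Periodic q L) :
    ∃ K > (0 : ℝ), ∀ a b : ℝ, ‖deriv q b - deriv q a‖ ≤ K * |b - a| := by
  have hq' : ContDiff ℝ 1 (deriv q) :=
    ((contDiff_succ_iff_deriv (n := 1)).1 (by simpa [one_add_one_eq_two] using hq)).2.2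
  obtain ⟨K, hK, hbound⟩ := ((deriv_periodic_of_periodic
    (deriv_periodic_of_periodic hper)).isBounded_of_continuous hL.ne'
    (hq'.continuous_deriv le_rfl)).exists_pos_norm_le
  refine ⟨K, hK, fun a b => ?_⟩
  simpa using Convex.norm_image_sub_le_of_norm_deriv_le (s := univ) (x := a) (y := b)
    (fun x _ => (hq'.differentiable one_ne_zero) x)
    (fun x _ => hbound _ (mem_range_self x)) convex_univ (mem_univ a) (mem_univ b)

lemma norm_sub_sub_smul_le_of_norm_deriv_sub_le [NormedSpace ℝ E] {c : ℝ → E}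
    (hc : Differentiable ℝ c) {v : E} {σ η ε : ℝ}
    (h : ∀ τ, |τ - σ| ≤ η → ‖deriv c τ - v‖ ≤ ε) {a b : ℝ}
    (ha : |a - σ| ≤ η) (hb : |b - σ| ≤ η) :
    ‖c b - c a - (b - a) • v‖ ≤ ε * |b - a| := by
  have hmem : ∀ x : ℝ, x ∈ Metric.closedBall σ η ↔ |x - σ| ≤ η := fun x => by
    rw [Metric.mem_closedBall, Real.dist_eq]
  have key := Convex.norm_image_sub_le_of_norm_hasDerivWithin_le
    (f := fun x => c x - x • v) (f' := fun x => deriv c x - (1 : ℝ) • v)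
    (s := Metric.closedBall σ η) (x := a) (y := b) (C := ε)
    (fun x _ => ((hc x).hasDerivAt.sub ((hasDerivAt_id x).smul_const v)).hasDerivWithinAt)
    (fun x hx => by simpa using h x ((hmem x).1 hx)) (convex_closedBall σ η)
    ((hmem a).2 ha) ((hmem b).2 hb)
  rw [Real.norm_eq_abs] at key
  convert key using 2
  simp only [sub_smul]
  abel

lemma HasDerivAt.norm_le_mul_norm_of_eventually_le {F : Type*} [NormedAddCommGroup F]
    [NormedSpace ℝ E] [NormedSpace ℝ F] {f : ℝ → E} {g : ℝ → F} {f' : E} {g' : F} {x C : ℝ}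
    (hf : HasDerivAt f f' x) (hg : HasDerivAt g g' x)
    (h : ∀ᶠ y in nhds x, ‖f y - f x‖ ≤ C * ‖g y - g x‖) : ‖f'‖ ≤ C * ‖g'‖ := by
  refine le_of_tendsto_of_tendsto (hasDerivAt_iff_tendsto_slope.1 hf).norm
    ((hasDerivAt_iff_tendsto_slope.1 hg).norm.const_mul C) ?_
  filter_upwards [h.filter_mono nhdsWithin_le_nhds] with y hy
  simp only [slope_def_module, norm_smul]
  calc _ ≤ ‖(y - x)⁻¹‖ * (C * ‖g y - g x‖) := by gcongr
    _ = _ := by ring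

lemma exists_abs_sub_le_eq_of_le_abs_deriv {g : ℝ → ℝ} (hg : Differentiable ℝ g)
    {x₀ t m y : ℝ} (ht : 0 ≤ t) (hm : 0 < m) (h : ∀ x, |x - x₀| ≤ t → m ≤ |deriv g x|)
    (hy : |y - g x₀| ≤ m * t) : ∃ x, |x - x₀| ≤ t ∧ g x = y := by
  have hmem : ∀ x : ℝ, x ∈ Icc (x₀ - t) (x₀ + t) ↔ |x - x₀| ≤ t := fun x => by
    rw [abs_le, mem_Icc]
    constructor <;> rintro ⟨h₁, h₂⟩ <;> constructor <;> linarith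
  have pos_case : ∀ {f : ℝ → ℝ} {z : ℝ}, Differentiable ℝ f →
      (∀ x ∈ Icc (x₀ - t) (x₀ + t), m ≤ deriv f x) → |z - f x₀| ≤ m * t →
      ∃ x, |x - x₀| ≤ t ∧ f x = z := by
    intro f z hf hder hz
    have mono := (convex_Icc (x₀ - t) (x₀ + t)).mul_sub_le_image_sub_of_le_deriv
      hf.continuous.continuousOn hf.differentiableOn
      (fun x hx => hder x (interior_subset hx))
    have h₁ := mono (x₀ - t) (by constructor <;> linarith) x₀ (by constructor <;> linarith)
      (by linarith)
    have h₂ := mono x₀ (by constructor <;> linarith) (x₀ + t) (by constructor <;> linarith)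
      (by linarith)
    rw [abs_le] at hz
    obtain ⟨x, hx, hxz⟩ := intermediate_value_Icc (a := x₀ - t) (b := x₀ + t) (by linarith)
      hf.continuous.continuousOn
      (show z ∈ Icc (f (x₀ - t)) (f (x₀ + t)) from ⟨by linarith, by linarith⟩)
    exact ⟨x, (hmem x).1 hx, hxz⟩
  rcases hasDerivWithinAt_forall_lt_or_forall_gt_of_forall_ne (convex_Icc (x₀ - t) (x₀ + t))
      (fun x _ => (hg x).hasDerivAt.hasDerivWithinAt) (m := 0)
      (fun x hx => abs_pos.1 (hm.trans_le (h x ((hmem x).1 hx)))) with hneg | hpos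
  · obtain ⟨x, hx, hxy⟩ := pos_case (f := fun x => -g x) (z := -y) hg.neg
      (fun x hx => by
        rw [deriv.fun_neg, ← abs_of_neg (hneg x hx)]
        exact h x ((hmem x).1 hx))
      (by rwa [neg_sub_neg, abs_sub_comm])
    exact ⟨x, hx, neg_injective hxy⟩
  · exact pos_case hg (fun x hx => by
      rw [← abs_of_pos (hpos x hx)]
      exact h x ((hmem x).1 hx)) hy

variable [InnerProductSpace ℝ E]

lemma inner_sub_deriv_eq_zero_of_forall_norm_le {c : ℝ → E} {σ : ℝ} (hc : DifferentiableAt ℝ c σ)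
    {Y : E} (hmin : ∀ τ, ‖Y - c σ‖ ≤ ‖Y - c τ‖) : ⟪Y - c σ, deriv c σ⟫ = 0 := by
  have hder := (hc.hasDerivAt.const_sub Y).norm_sq
  have hloc : IsLocalMin (fun τ => ‖Y - c τ‖ ^ 2) σ :=
    Eventually.of_forall fun τ => by
      have := hmin τ
      dsimp only
      gcongr
  have := hloc.hasDerivAt_eq_zero hder
  rw [inner_neg_right] at this
  linarith

/-- A curve with unit-norm derivative that stays in a nearly straight arc `c` moves along that
arc at a speed comparable to the parameter speed of `c`. -/
lemma exists_abs_sub_le_eq_of_nearly_straight {c Q : ℝ → E} {v : E} {σ φ₀ η a : ℝ}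
    (hv : ‖v‖ = 1) (hc : Differentiable ℝ c)
    (hder : ∀ τ, |τ - σ| ≤ η → ‖deriv c τ - v‖ ≤ 1 / 2)
    (hQ : ∀ φ, ‖deriv Q φ‖ = 1) (h₀ : Q φ₀ = c σ)
    (hcov : ∀ φ, |φ - φ₀| < a → ∃ τ, |τ - σ| ≤ η ∧ c τ = Q φ)
    {τ : ℝ} (hτ : |τ - σ| ≤ η) (hsmall : 5 * |τ - σ| < a) :
    ∃ φ, Q φ = c τ ∧ |φ - φ₀| ≤ 5 * |τ - σ| := by
  have hQd : Differentiable ℝ Q := fun φ => by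
    by_contra h
    have := hQ φ
    rw [deriv_zero_of_not_differentiableAt h] at this
    norm_num at this
  have hlin : ∀ {x y : ℝ}, |x - σ| ≤ η → |y - σ| ≤ η →
      ‖c y - c x - (y - x) • v‖ ≤ 1 / 2 * |y - x| := fun hx hy =>
    norm_sub_sub_smul_le_of_norm_deriv_sub_le hc hder hx hy
  have hupper : ∀ {x y : ℝ}, |x - σ| ≤ η → |y - σ| ≤ η → ‖c y - c x‖ ≤ 3 / 2 * |y - x| := by
    intro x y hx hy
    have h₁ := norm_add_le (c y - c x - (y - x) • v) ((y - x) • v)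
    rw [sub_add_cancel, norm_smul, hv, Real.norm_eq_abs] at h₁
    linarith [hlin hx hy]
  have hlower : ∀ {x y : ℝ}, |x - σ| ≤ η → |y - σ| ≤ η →
      1 / 2 * |y - x| ≤ |⟪v, c y - c x⟫| := by
    intro x y hx hy
    have h₁ := abs_real_inner_le_norm v (c y - c x - (y - x) • v)
    rw [inner_sub_right, real_inner_smul_right, real_inner_self_eq_norm_sq, hv] at h₁
    have h₂ := abs_sub_abs_le_abs_sub (y - x) ⟪v, c y - c x⟫
    rw [abs_sub_comm (y - x)] at h₂
    norm_num at h₁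
    linarith [hlin hx hy]
  let g : ℝ → ℝ := fun φ => ⟪v, Q φ⟫
  have hg : Differentiable ℝ g := (differentiable_const v).inner ℝ hQd
  have hgder : ∀ φ, |φ - φ₀| < a → 1 / 3 ≤ |deriv g φ| := by
    intro φ hφ
    have hev : ∀ᶠ ψ in nhds φ, ‖Q ψ - Q φ‖ ≤ 3 * ‖g ψ - g φ‖ := by
      have : ∀ᶠ ψ in nhds φ, |ψ - φ₀| < a :=
        (show Continuous fun ψ : ℝ => |ψ - φ₀| by fun_prop).continuousAt.eventually_lt_const hφ
      filter_upwards [this] with ψ hψ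
      obtain ⟨x, hx, hxφ⟩ := hcov φ hφ
      obtain ⟨y, hy, hyψ⟩ := hcov ψ hψ
      have h₁ := hlower hx hy
      have h₂ := hupper hx hy
      simp only [g, ← inner_sub_right, ← hxφ, ← hyψ, Real.norm_eq_abs]
      linarith
    have := (hQd φ).hasDerivAt.norm_le_mul_norm_of_eventually_le (hg φ).hasDerivAt hev
    rw [hQ φ, Real.norm_eq_abs] at this
    linarith
  have hσ : |σ - σ| ≤ η := by simpa using (abs_nonneg _).trans hτ
  obtain ⟨φ, hφ, hgφ⟩ := exists_abs_sub_le_eq_of_le_abs_deriv hg (x₀ := φ₀)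
    (t := 5 * |τ - σ|) (m := 1 / 3) (y := ⟪v, c τ⟫) (by positivity) (by norm_num)
    (fun x hx => hgder x (hx.trans_lt hsmall)) (by
      have h₁ := abs_real_inner_le_norm v (c τ - c σ)
      have h₂ := hupper hσ hτ
      simp only [g, h₀, ← inner_sub_right]
      rw [hv] at h₁
      linarith [abs_nonneg (τ - σ)])
  obtain ⟨x, hx, hxφ⟩ := hcov φ (hφ.trans_lt hsmall)
  refine ⟨φ, ?_, hφ⟩
  have h₁ := hlower hx hτ
  rw [inner_sub_right, hxφ, ← hgφ, sub_self, abs_zero] at h₁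
  rw [← hxφ, eq_of_sub_eq_zero (abs_eq_zero.1 (le_antisymm (by linarith) (abs_nonneg (τ - x))))]

/-- Quantitative form of the uniqueness of the nearest-point phase: an approximate critical point
of the distance to `Y` along a unit-speed curve is close to any critical point nearby. -/
lemma abs_sub_le_two_mul_abs_inner_of_inner_eq_zero {q : ℝ → E} (hq : Differentiable ℝ q)
    (hunit : ∀ θ, ‖deriv q θ‖ = 1) {K : ℝ} (hK : 0 ≤ K)
    (hlip : ∀ a b : ℝ, ‖deriv q b - deriv q a‖ ≤ K * |b - a|) {Y : E} {θ σ : ℝ}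
    (hθ : ⟪Y - q θ, deriv q θ⟫ = 0) (hclose : K * |θ - σ| + K * ‖Y - q σ‖ ≤ 1 / 2) :
    |θ - σ| ≤ 2 * |⟪Y - q σ, deriv q σ⟫| := by
  have hlin : ‖q σ - q θ - (σ - θ) • deriv q θ‖ ≤ K * |θ - σ| * |σ - θ| :=
    norm_sub_sub_smul_le_of_norm_deriv_sub_le hq (σ := θ) (η := |θ - σ|)
      (fun τ hτ => (hlip θ τ).trans (by gcongr)) (by simp) (abs_sub_comm σ θ).le
  have h₁ := abs_real_inner_le_norm (q σ - q θ - (σ - θ) • deriv q θ) (deriv q θ)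
  have h₂ := abs_real_inner_le_norm (Y - q σ) (deriv q σ - deriv q θ)
  rw [hunit, mul_one] at h₁
  have h₃ : ‖Y - q σ‖ * ‖deriv q σ - deriv q θ‖ ≤ ‖Y - q σ‖ * (K * |σ - θ|) := by
    gcongr
    exact hlip θ σ
  have hid : θ - σ = ⟪Y - q σ, deriv q σ⟫ + ⟪q σ - q θ - (σ - θ) • deriv q θ, deriv q θ⟫
      - ⟪Y - q σ, deriv q σ - deriv q θ⟫ := by
    have hself : ⟪deriv q θ, deriv q θ⟫ = 1 := by
      rw [real_inner_self_eq_norm_sq, hunit, one_pow]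
    simp only [inner_sub_left, inner_sub_right, real_inner_smul_left, hself] at hθ ⊢
    linarith
  have h₄ : |θ - σ| ≤ |⟪Y - q σ, deriv q σ⟫|
      + |⟪q σ - q θ - (σ - θ) • deriv q θ, deriv q θ⟫|
      + |⟪Y - q σ, deriv q σ - deriv q θ⟫| := by
    conv_lhs => rw [hid]
    exact (abs_sub _ _).trans (by gcongr; exact abs_add_le _ _)
  rw [abs_sub_comm σ θ] at hlin h₃
  nlinarith [abs_nonneg (θ - σ)]

end CurveLemmas

/-- Lemma 2.6: comparison of the two projections `p̃_δ` and `p_δ` near `M^δ`. -/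
theorem projection_comparison {n : ℕ}
    (V : EuclideanSpace ℝ (Fin n) → ℝ) (G : EuclideanSpace ℝ (Fin n) → EuclideanSpace ℝ (Fin n))
    (q : ℝ → EuclideanSpace ℝ (Fin n)) (L lam : ℝ)
    (hV : ContDiff ℝ 4 V) (hG : ContDiff ℝ 2 G)
    (hL : 0 < L) (hq : ContDiff ℝ 3 q) (hqper : Function.Periodic q L)
    (hqunit : ∀ θ, ‖deriv q θ‖ = 1)
    (hqinj : ∀ θ₁ θ₂ : ℝ, q θ₁ = q θ₂ → ∃ k : ℤ, θ₂ - θ₁ = k * L)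
    (hgrad : ∀ θ, gradient V (q θ) = 0) (hV0 : ∀ θ, V (q θ) = 0)
    (hHtan : ∀ θ, hessLM V (q θ) (deriv q θ) = 0)
    (hlam : 0 < lam)
    (hspec : ∀ θ : ℝ, ∀ w : EuclideanSpace ℝ (Fin n), ⟪w, deriv q θ⟫ = 0 →
      lam * ‖w‖ ^ 2 ≤ ⟪hessLM V (q θ) w, w⟫)
    (Φ : ℝ → ℝ → EuclideanSpace ℝ (Fin n)) (δ₁ CΦ : ℝ) (hδ₁ : 0 < δ₁) (hCΦ : 0 < CΦ)
    (hΦ : ∀ δ ∈ Ioc (0:ℝ) δ₁, ContDiff ℝ 2 (Φ δ) ∧ Function.Periodic (Φ δ) L ∧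
      (∀ θ, ⟪Φ δ θ, deriv q θ⟫ = 0) ∧
      (∀ θ, ‖Φ δ θ‖ ≤ CΦ * δ ∧ ‖deriv (Φ δ) θ‖ ≤ CΦ * δ ∧ ‖deriv (deriv (Φ δ)) θ‖ ≤ CΦ * δ) ∧
      flowInvariant V G δ (Mset q Φ δ))
    (Qd : ℝ → ℝ → EuclideanSpace ℝ (Fin n)) (Ld : ℝ → ℝ)
    (hQd : ∀ δ ∈ Ioc (0:ℝ) δ₁, 0 < Ld δ ∧ Function.Periodic (Qd δ) (Ld δ) ∧
      (∀ φ, ‖deriv (Qd δ) φ‖ = 1) ∧ Set.range (Qd δ) = Mset q Φ δ)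
    (Pd : ℝ → EuclideanSpace ℝ (Fin n) → ℝ) (r₀ : ℝ) (hr₀ : 0 < r₀)
    (hPd : ∀ δ ∈ Ioc (0:ℝ) δ₁, ∀ Z : EuclideanSpace ℝ (Fin n), Metric.infDist Z (Mset q Φ δ) ≤ r₀ →
      ‖Z - Qd δ (Pd δ Z)‖ = Metric.infDist Z (Mset q Φ δ))
    (P : EuclideanSpace ℝ (Fin n) → ℝ) (r₁ : ℝ) (hr₁ : 0 < r₁)
    (hP : ∀ Z : EuclideanSpace ℝ (Fin n), Metric.infDist Z (Set.range q) ≤ r₁ →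
      ‖Z - q (P Z)‖ = Metric.infDist Z (Set.range q))
    :
    ∃ δ₀ > (0:ℝ), ∃ r > (0:ℝ), ∃ C > (0:ℝ), ∀ δ : ℝ, 0 < δ → δ ≤ δ₀ →
      ∀ Y : EuclideanSpace ℝ (Fin n), Metric.infDist Y (Mset q Φ δ) ≤ r →
        ∃ φ : ℝ, Qd δ φ = q (P Y) + Φ δ (P Y) ∧
          |φ - Pd δ Y| ≤ C * δ * Metric.infDist Y (Mset q Φ δ) := by
  have hqd : Differentiable ℝ q := hq.differentiable (by norm_num)
  obtain ⟨K, hK, hlip⟩ := exists_norm_deriv_sub_le_of_periodic hL (hq.of_le (by norm_num)) hqper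
  set η : ℝ := 1 / (4 * K) with hη_def
  have hη : 0 < η := by positivity
  have hKη : K * η = 1 / 4 := by rw [hη_def]; field_simp
  obtain ⟨ρ, hρ, hsep⟩ :=
    exists_int_abs_add_sub_lt_of_periodic hL hq.continuous hqper hqinj hη
  set κ : ℝ := min (min (1 / 4) (η / 2)) (min (ρ / 8) (min (r₁ / 2) r₀)) with hκ_def
  have hκ : 0 < κ := by positivity
  have hκ₁ : κ ≤ 1 / 4 := (min_le_left _ _).trans (min_le_left _ _)
  have hκ₂ : κ ≤ η / 2 := (min_le_left _ _).trans (min_le_right _ _)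
  have hκ₃ : κ ≤ ρ / 8 := (min_le_right _ _).trans (min_le_left _ _)
  have hκ₄ : κ ≤ r₁ / 2 :=
    (min_le_right _ _).trans ((min_le_right _ _).trans (min_le_left _ _))
  have hκ₅ : κ ≤ r₀ := (min_le_right _ _).trans ((min_le_right _ _).trans (min_le_right _ _))
  refine ⟨min δ₁ (κ / CΦ), by positivity, κ, hκ, 10 * CΦ, by positivity, ?_⟩
  intro δ hδ hδle Y hY
  have hδmem : δ ∈ Ioc (0 : ℝ) δ₁ := ⟨hδ, hδle.trans (min_le_left _ _)⟩
  have hΦκ : CΦ * δ ≤ κ := by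
    have := (le_div_iff₀ hCΦ).1 (hδle.trans (min_le_right _ _))
    linarith
  obtain ⟨hΦC2, hΦper, hΦorth, hΦbd, -⟩ := hΦ δ hδmem
  obtain ⟨-, -, hQunit, hQrange⟩ := hQd δ hδmem
  have hPdY := hPd δ hδmem Y (hY.trans hκ₅)
  set d : ℝ := Metric.infDist Y (Mset q Φ δ) with hd
  have hd0 : 0 ≤ d := Metric.infDist_nonneg
  have hΦd : Differentiable ℝ (Φ δ) := hΦC2.differentiable (by norm_num)
  set c : ℝ → EuclideanSpace ℝ (Fin n) := fun θ => q θ + Φ δ θ with hc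
  have hcd : Differentiable ℝ c := hqd.add hΦd
  have hcder : ∀ τ, deriv c τ = deriv q τ + deriv (Φ δ) τ := fun τ =>
    deriv_add (hqd τ) (hΦd τ)
  have hcper : Function.Periodic c L := fun θ => by simp only [hc, hqper θ, hΦper θ]
  have lift : ∀ φ, ∃ τ, c τ = Qd δ φ := fun φ => by
    have : Qd δ φ ∈ Mset q Φ δ := hQrange ▸ mem_range_self φ
    exact this
  obtain ⟨σ, hσ⟩ := lift (Pd δ Y)
  have hdσ : ‖Y - c σ‖ = d := by rw [hσ, hPdY]
  have hYσ : ‖Y - q σ‖ ≤ d + CΦ * δ := by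
    calc ‖Y - q σ‖ = ‖(Y - c σ) + Φ δ σ‖ := by simp only [hc]; congr 1; abel
      _ ≤ ‖Y - c σ‖ + ‖Φ δ σ‖ := norm_add_le _ _
      _ ≤ d + CΦ * δ := add_le_add hdσ.le (hΦbd σ).1
  have hinf : Metric.infDist Y (range q) ≤ ‖Y - q σ‖ := by
    rw [← dist_eq_norm]
    exact Metric.infDist_le_dist_of_mem (mem_range_self σ)
  have hPY := hP Y (by linarith)
  have hqPσ : ‖q (P Y) - q σ‖ < ρ := by
    calc ‖q (P Y) - q σ‖ = ‖(Y - q σ) - (Y - q (P Y))‖ := by congr 1; abel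
      _ ≤ ‖Y - q σ‖ + ‖Y - q (P Y)‖ := norm_sub_le _ _
      _ < ρ := by linarith
  obtain ⟨k, hk⟩ := hsep _ _ hqPσ
  set θ : ℝ := P Y + k * L with hθ
  have hqθ : q θ = q (P Y) := hqper.int_mul k (P Y)
  have hcθ : c θ = c (P Y) := hcper.int_mul k (P Y)
  have hθcrit : ⟪Y - q θ, deriv q θ⟫ = 0 :=
    inner_sub_deriv_eq_zero_of_forall_norm_le (hqd θ) fun τ => by
      rw [hqθ, hPY, ← dist_eq_norm]
      exact Metric.infDist_le_dist_of_mem (mem_range_self τ)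
  have hσcrit : ⟪Y - c σ, deriv c σ⟫ = 0 :=
    inner_sub_deriv_eq_zero_of_forall_norm_le (hcd σ) fun τ => by
      rw [hdσ, hd, ← dist_eq_norm]
      exact Metric.infDist_le_dist_of_mem ⟨τ, rfl⟩
  have hdefect : |⟪Y - q σ, deriv q σ⟫| ≤ d * (CΦ * δ) := by
    have hid : ⟪Y - q σ, deriv q σ⟫ = -⟪Y - c σ, deriv (Φ δ) σ⟫ := by
      have horth := hΦorth σ
      rw [hcder, inner_add_right] at hσcrit
      have : Y - q σ = (Y - c σ) + Φ δ σ := by simp only [hc]; abel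
      rw [this, inner_add_left]
      linarith
    rw [hid, abs_neg]
    refine (abs_real_inner_le_norm _ _).trans ?_
    rw [hdσ]
    gcongr
    exact (hΦbd σ).2.1
  have hθσ : |θ - σ| ≤ 2 * (d * (CΦ * δ)) := by
    refine (abs_sub_le_two_mul_abs_inner_of_inner_eq_zero hqd hqunit hK.le hlip hθcrit
      ?_).trans (by linarith)
    have h₁ : K * |θ - σ| ≤ K * η := by gcongr
    have h₂ : K * ‖Y - q σ‖ ≤ K * η := by
      gcongr
      linarith
    linarith
  have hdsmall : d * (CΦ * δ) ≤ ρ / 8 * (1 / 4) :=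
    mul_le_mul (hY.trans hκ₃) (hΦκ.trans hκ₁) (by positivity) (by positivity)
  obtain ⟨φ, hφ, hφle⟩ := exists_abs_sub_le_eq_of_nearly_straight (a := ρ / 2) (η := η)
    (hqunit σ) hcd (fun τ hτ => by
      calc ‖deriv c τ - deriv q σ‖ = ‖(deriv q τ - deriv q σ) + deriv (Φ δ) τ‖ := by
            rw [hcder]; congr 1; abel
        _ ≤ ‖deriv q τ - deriv q σ‖ + ‖deriv (Φ δ) τ‖ := norm_add_le _ _
        _ ≤ K * η + CΦ * δ :=
            add_le_add ((hlip σ τ).trans (by gcongr)) (hΦbd τ).2.1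
        _ ≤ 1 / 2 := by linarith) hQunit hσ.symm (fun ψ hψ => by
      obtain ⟨τ, hτ⟩ := lift ψ
      have hQlip : ‖Qd δ ψ - Qd δ (Pd δ Y)‖ ≤ 1 * ‖ψ - Pd δ Y‖ :=
        Convex.norm_image_sub_le_of_norm_deriv_le (s := univ)
          (fun x _ => differentiableAt_of_deriv_ne_zero fun h => by
            simpa [h] using hQunit x)
          (fun x _ => (hQunit x).le) convex_univ (mem_univ _) (mem_univ _)
      rw [one_mul, Real.norm_eq_abs, ← hσ, ← hτ] at hQlip
      have hqτ : ‖q τ - q σ‖ < ρ := by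
        calc ‖q τ - q σ‖ = ‖(c τ - c σ) - (Φ δ τ - Φ δ σ)‖ := by
              simp only [hc]; congr 1; abel
          _ ≤ ‖c τ - c σ‖ + ‖Φ δ τ - Φ δ σ‖ := norm_sub_le _ _
          _ ≤ ‖c τ - c σ‖ + (‖Φ δ τ‖ + ‖Φ δ σ‖) := by gcongr; exact norm_sub_le _ _
          _ < ρ := by linarith [(hΦbd τ).1, (hΦbd σ).1]
      obtain ⟨l, hl⟩ := hsep _ _ hqτ
      exact ⟨τ + l * L, hl.le, (hcper.int_mul l τ).trans hτ⟩) hk.le (by linarith)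
  exact ⟨φ, hφ.trans hcθ, by linarith⟩

end
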